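/- arXiv:1409.5340 — 11 statements merged into one kernel-verified Lean document; each statement's English description precedes it below -/
import Mathlib

section
/- Let K₁, K₂ be conjunctions of literals given by (S₁, f₁) and (S₂, f₂), and let w₁, w₂ be positive integers. (a) If w₁ > w₂, then the merge of K₁, K₂ with weights (w₁,w₂) equals {I | (∀ x ∈ S₁, I x = f₁ x) and (∀ x ∈ S₂ \ S₁, I x = f₂ x)}. (b) If w₁ = w₂, then, letting D = {x ∈ S₁ ∩ S₂ | f₁ x ≠ f₂ x}, the merge equals {I | (∀ x ∈ S₁ \ D, I x = f₁ x) and (∀ x ∈ S₂ \ D, I x = f₂ x)}. (c) If w₁ < w₂, then the merge equals {I | (∀ x ∈ S₂, I x = f₂ x) and (∀ x ∈ S₁ \ S₂, I x = f₁ x)}. -/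
/-- Hamming distance between two interpretations: the number of variables on
which they differ. -/
def hamming {V : Type*} [Fintype V] (I J : V → Bool) : ℕ :=
  (Finset.univ.filter fun x => I x ≠ J x).card

/-- Distance from an interpretation to a knowledge base (a set of
interpretations): the minimal Hamming distance to one of its models. -/
noncomputable def distToKB {V : Type*} [Fintype V] (I : V → Bool)
    (K : Set (V → Bool)) : ℕ :=
  sInf (hamming I '' K)

/-- The models of a conjunction of literals given by a set `S` of variables
together with a sign function `f`. -/
def litModels {V : Type*} (S : Finset V) (f : V → Bool) : Set (V → Bool) :=
  {I | ∀ x ∈ S, I x = f x}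

/-- The merge of `K₁, K₂` with weights `(w₁, w₂)`: the set of interpretations
minimizing `w₁·d(I,K₁) + w₂·d(I,K₂)`. -/
noncomputable def wmergeKB {V : Type*} [Fintype V]
    (K₁ K₂ : Set (V → Bool)) (w₁ w₂ : ℕ) : Set (V → Bool) :=
  {I | ∀ J : V → Bool,
    w₁ * distToKB I K₁ + w₂ * distToKB I K₂ ≤
      w₁ * distToKB J K₁ + w₂ * distToKB J K₂}

theorem distToKB_litModels {V : Type*} [Fintype V] [DecidableEq V]
    (I : V → Bool) (S : Finset V) (f : V → Bool) :
    distToKB I (litModels S f) = ∑ x, if x ∈ S ∧ I x ≠ f x then 1 else 0 := by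
  rw [← Finset.card_filter]
  apply le_antisymm
  · refine Nat.sInf_le ⟨fun x => if x ∈ S then f x else I x, ?_, ?_⟩
    · intro x hx
      simp [hx]
    · unfold hamming
      congr 1
      ext x
      by_cases hx : x ∈ S <;> simp [hx]
  · have hne : (hamming I '' litModels S f).Nonempty := ⟨_, f, fun _ _ => rfl, rfl⟩
    refine le_csInf hne ?_
    rintro _ ⟨J, hJ, rfl⟩
    refine Finset.card_le_card fun x hx => ?_
    simp only [Finset.mem_filter, Finset.mem_univ, true_and] at hx ⊢
    rw [hJ x hx.1]
    exact hx.2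

theorem sum_apply_minimal_iff {V α : Type*} [Fintype V] [DecidableEq V]
    (c : V → α → ℕ) (I : V → α) :
    (∀ J : V → α, ∑ x, c x (I x) ≤ ∑ x, c x (J x)) ↔ ∀ x a, c x (I x) ≤ c x a := by
  refine ⟨fun h x a => ?_, fun h J => Finset.sum_le_sum fun x _ => h x (J x)⟩
  have hrest : ∑ y ∈ Finset.univ.erase x, c y (Function.update I x a y) =
      ∑ y ∈ Finset.univ.erase x, c y (I y) :=
    Finset.sum_congr rfl fun y hy => by
      rw [Function.update_of_ne (Finset.ne_of_mem_erase hy)]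
  have hx := h (Function.update I x a)
  rw [← Finset.add_sum_erase _ _ (Finset.mem_univ x),
    ← Finset.add_sum_erase _ (fun y => c y (Function.update I x a y)) (Finset.mem_univ x),
    hrest] at hx
  simpa using hx

theorem mem_wmergeKB_litModels_iff {V : Type*} [Fintype V] [DecidableEq V]
    (S₁ S₂ : Finset V) (f₁ f₂ : V → Bool) (w₁ w₂ : ℕ) (I : V → Bool) :
    I ∈ wmergeKB (litModels S₁ f₁) (litModels S₂ f₂) w₁ w₂ ↔
      ∀ x b, ((if x ∈ S₁ ∧ I x ≠ f₁ x then w₁ else 0) +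
          if x ∈ S₂ ∧ I x ≠ f₂ x then w₂ else 0) ≤
        (if x ∈ S₁ ∧ b ≠ f₁ x then w₁ else 0) + if x ∈ S₂ ∧ b ≠ f₂ x then w₂ else 0 := by
  rw [← sum_apply_minimal_iff fun x b =>
    (if x ∈ S₁ ∧ b ≠ f₁ x then w₁ else 0) + if x ∈ S₂ ∧ b ≠ f₂ x then w₂ else 0]
  simp only [wmergeKB, Set.mem_ofPred_eq, distToKB_litModels, Finset.mul_sum, mul_ite, mul_one,
    mul_zero, Finset.sum_add_distrib]

theorem stmt_3 {V : Type*} [Fintype V] [DecidableEq V]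
    (S₁ S₂ : Finset V) (f₁ f₂ : V → Bool) (w₁ w₂ : ℕ)
    (hw₁ : 0 < w₁) (hw₂ : 0 < w₂) :
    (w₂ < w₁ →
      wmergeKB (litModels S₁ f₁) (litModels S₂ f₂) w₁ w₂ =
        {I | (∀ x ∈ S₁, I x = f₁ x) ∧ ∀ x ∈ S₂ \ S₁, I x = f₂ x}) ∧
    (w₁ = w₂ →
      wmergeKB (litModels S₁ f₁) (litModels S₂ f₂) w₁ w₂ =
        {I | (∀ x ∈ S₁ \ ((S₁ ∩ S₂).filter fun x => f₁ x ≠ f₂ x), I x = f₁ x) ∧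
          ∀ x ∈ S₂ \ ((S₁ ∩ S₂).filter fun x => f₁ x ≠ f₂ x), I x = f₂ x}) ∧
    (w₁ < w₂ →
      wmergeKB (litModels S₁ f₁) (litModels S₂ f₂) w₁ w₂ =
        {I | (∀ x ∈ S₂, I x = f₂ x) ∧ ∀ x ∈ S₁ \ S₂, I x = f₁ x}) := by
  refine ⟨fun h => ?_, fun h => ?_, fun h => ?_⟩ <;> ext I <;>
    simp only [mem_wmergeKB_litModels_iff, Set.mem_ofPred_eq, Finset.mem_sdiff,
      Finset.mem_filter, Finset.mem_inter, ← forall_and] <;>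
    refine forall_congr' fun x => ?_ <;>
    rw [Bool.forall_bool] <;>
    by_cases h₁ : x ∈ S₁ <;> by_cases h₂ : x ∈ S₂ <;>
    cases I x <;> cases f₁ x <;> cases f₂ x <;> simp [h₁, h₂] <;> omega
end

section
/- If M is a maxset of the family (K i) that is minimal with respect to a priority ordering P, then there exists i ∈ M with P i = 1. -/
/-- The models of a set `M` of formula indices: the interpretations satisfying
`K i` for every `i ∈ M`. -/
def KMod {V ι : Type*} (K : ι → Set (V → Bool)) (M : Set ι) : Set (V → Bool) :=
  {I | ∀ i ∈ M, I ∈ K i}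

/-- A set of formula indices is consistent if it has a model. -/
def ConsistentSet {V ι : Type*} (K : ι → Set (V → Bool)) (M : Set ι) : Prop :=
  (KMod K M).Nonempty

/-- A maxset: a maximally consistent subset of the family. -/
def Maxset {V ι : Type*} (K : ι → Set (V → Bool)) (M : Set ι) : Prop :=
  ConsistentSet K M ∧ ∀ j ∉ M, ¬ ConsistentSet K (M ∪ {j})

/-- A priority ordering: every formula is in some class `≥ 1`, and the first
class is nonempty. -/
def PriorityOrdering {ι : Type*} (P : ι → ℕ) : Prop :=
  (∀ i, 1 ≤ P i) ∧ (∃ i, P i = 1)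

/-- The comparison of sets of formulae induced by a priority ordering `P`. -/
def PLt {ι : Type*} (P : ι → ℕ) (M N : Set ι) : Prop :=
  ∃ n, 1 ≤ n ∧ (∀ m, 1 ≤ m → m < n → {i ∈ M | P i = m} = {i ∈ N | P i = m}) ∧
    {i ∈ N | P i = n} ⊂ {i ∈ M | P i = n}

/-- A maxset is minimal w.r.t. `P` when no consistent set is below it. -/
def MinimalMaxset {V ι : Type*} (K : ι → Set (V → Bool)) (P : ι → ℕ)
    (M : Set ι) : Prop :=
  Maxset K M ∧ ¬ ∃ N : Set ι, ConsistentSet K N ∧ PLt P N M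

/-- The result of merging the family `K` under the priority ordering `P`:
the union of the models of the minimal maxsets. -/
def MergeResult {V ι : Type*} (K : ι → Set (V → Bool)) (P : ι → ℕ) :
    Set (V → Bool) :=
  ⋃ M ∈ {M : Set ι | MinimalMaxset K P M}, KMod K M

theorem stmt_7 {V ι : Type*} [Fintype V] [Fintype ι] [Nonempty ι]
    (K : ι → Set (V → Bool)) (hK : ∀ i, (K i).Nonempty)
    (P : ι → ℕ) (hP : PriorityOrdering P)
    (M : Set ι) (hM : MinimalMaxset K P M) :
    ∃ i ∈ M, P i = 1 := by
  obtain ⟨i, hi⟩ := hP.2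
  by_contra! h
  obtain ⟨I, hI⟩ := hK i
  refine hM.2 ⟨{i}, ⟨I, by rintro _ rfl; exact hI⟩, 1, le_rfl, fun m _ _ => by omega, ?_⟩
  refine Set.ssubset_iff_exists.2 ⟨fun j hj => (h j hj.1 hj.2).elim, i, ⟨rfl, hi⟩, ?_⟩
  exact fun hiM => h i hiM.1 hi
end

section
/- Let ι be a finite nonempty type and let S be a nonempty finite family of subsets of ι such that no member of S is strictly contained in another member of S and every i ∈ ι belongs to some member of S. Then there exist a finite set V of propositional variables and a family (K i)_{i ∈ ι} of consistent formulas (nonempty sets of interpretations I : V → Bool) whose set of maxsets is exactly S. -/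
/-- If consistency means being contained in a member of the antichain `S`, then the maxsets are
exactly the members of `S`. -/
theorem setOf_maxset_eq_of_consistentSet_iff {V ι : Type*} {K : ι → Set (V → Bool)}
    {S : Set (Set ι)} (hanti : ∀ M ∈ S, ∀ N ∈ S, ¬ M ⊂ N)
    (hK : ∀ M, ConsistentSet K M ↔ ∃ N ∈ S, M ⊆ N) : {M : Set ι | Maxset K M} = S := by
  ext M
  simp only [Set.mem_ofPred_eq, Maxset, hK]
  constructor
  · rintro ⟨⟨N, hN, hMN⟩, hmax⟩
    have hNM : N ⊆ M := fun j hj => by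
      by_contra hjM
      exact hmax j hjM ⟨N, hN, Set.union_subset hMN (Set.singleton_subset_iff.2 hj)⟩
    rwa [hMN.antisymm hNM]
  · refine fun hM => ⟨⟨M, hM, subset_rfl⟩, ?_⟩
    rintro j hj ⟨N, hN, hMN⟩
    exact hanti M hM N hN
      ⟨Set.subset_union_left.trans hMN, fun h => hj (h (hMN (Or.inr rfl)))⟩

/-- The formulas whose models encode the members of `S` containing a given index, where `e` assigns
a variable to each index. -/
def memberFormula {V ι : Type*} (e : ι ≃ V) (S : Set (Set ι)) (i : ι) : Set (V → Bool) :=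
  {I | {j | I (e j) = true} ∈ S ∧ I (e i) = true}

theorem consistentSet_memberFormula_iff {V ι : Type*} (e : ι ≃ V) {S : Set (Set ι)}
    (hS : S.Nonempty) (M : Set ι) :
    ConsistentSet (memberFormula e S) M ↔ ∃ N ∈ S, M ⊆ N := by
  classical
  constructor
  · rintro ⟨I, hI⟩
    obtain rfl | ⟨i, hi⟩ := M.eq_empty_or_nonempty
    · exact hS.imp fun N hN => ⟨hN, Set.empty_subset N⟩
    · exact ⟨_, (hI i hi).1, fun j hj => (hI j hj).2⟩
  · rintro ⟨N, hN, hMN⟩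
    exact ⟨fun v => decide (e.symm v ∈ N), fun i hi => by
      simpa [memberFormula, hN] using hMN hi⟩

theorem stmt_8 {ι : Type*} [Fintype ι] [Nonempty ι]
    (S : Set (Set ι)) (hSfin : S.Finite) (hSne : S.Nonempty)
    (hanti : ∀ M ∈ S, ∀ N ∈ S, ¬ M ⊂ N)
    (hcover : ∀ i : ι, ∃ M ∈ S, i ∈ M) :
    ∃ (V : Type) (_ : Fintype V) (K : ι → Set (V → Bool)),
      (∀ i, (K i).Nonempty) ∧ {M : Set ι | Maxset K M} = S := by
  have hK := consistentSet_memberFormula_iff (Fintype.equivFin ι) hSne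
  refine ⟨Fin (Fintype.card ι), inferInstance, memberFormula (Fintype.equivFin ι) S,
    fun i => ?_, setOf_maxset_eq_of_consistentSet_iff hanti hK⟩
  obtain ⟨M, hM, hi⟩ := hcover i
  obtain ⟨I, hI⟩ := (hK {i}).2 ⟨M, hM, Set.singleton_subset_iff.2 hi⟩
  exact ⟨I, hI i rfl⟩
end

section
/- Let M₀ be a maxset of the family (K i) and define P : ι → ℕ by P i = 1 if i ∈ M₀ and P i = 2 otherwise. Then P is a priority ordering, and a maxset M is minimal with respect to P if and only if M = M₀. -/
theorem ConsistentSet.mono {V ι : Type*} {K : ι → Set (V → Bool)} {M N : Set ι}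
    (hN : ConsistentSet K N) (h : M ⊆ N) : ConsistentSet K M :=
  let ⟨I, hI⟩ := hN
  ⟨I, fun i hi => hI i (h hi)⟩

theorem Maxset.eq_of_subset {V ι : Type*} {K : ι → Set (V → Bool)} {M N : Set ι}
    (hM : Maxset K M) (hN : ConsistentSet K N) (h : M ⊆ N) : M = N := by
  refine h.antisymm fun j hj => ?_
  by_contra hjM
  exact hM.2 j hjM (hN.mono (Set.union_subset h (Set.singleton_subset_iff.2 hj)))

theorem Maxset.nonempty {V ι : Type*} [Nonempty ι] {K : ι → Set (V → Bool)} {M : Set ι}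
    (hM : Maxset K M) (hK : ∀ i, (K i).Nonempty) : M.Nonempty := by
  by_contra h
  rw [Set.not_nonempty_iff_eq_empty] at h
  subst h
  obtain ⟨j⟩ := ‹Nonempty ι›
  obtain ⟨I, hI⟩ := hK j
  exact hM.2 j (Set.notMem_empty j) ⟨I, by simpa [KMod] using hI⟩

theorem stmt_10 {V ι : Type*} [Fintype V] [Fintype ι] [Nonempty ι]
    (K : ι → Set (V → Bool)) (hK : ∀ i, (K i).Nonempty)
    (M₀ : Set ι) (hM₀ : Maxset K M₀)
    (P : ι → ℕ) (hP₁ : ∀ i ∈ M₀, P i = 1) (hP₂ : ∀ i ∉ M₀, P i = 2) :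
    PriorityOrdering P ∧ ∀ M : Set ι, Maxset K M → (MinimalMaxset K P M ↔ M = M₀) := by
  have hP : ∀ i, P i = 1 → i ∈ M₀ := fun i hi => by
    by_contra h
    simp [hP₂ i h] at hi
  refine ⟨⟨fun i => ?_, ?_⟩, fun M hM => ⟨?_, ?_⟩⟩
  · by_cases h : i ∈ M₀
    · exact (hP₁ i h).ge
    · simp [hP₂ i h]
  · obtain ⟨i, hi⟩ := hM₀.nonempty hK
    exact ⟨i, hP₁ i hi⟩
  · rintro ⟨-, hmin⟩
    by_contra hne
    have hsub : ¬ M₀ ⊆ M := fun h => hne (hM₀.eq_of_subset hM.1 h).symm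
    obtain ⟨i, hi, hiM⟩ := Set.not_subset.1 hsub
    refine hmin ⟨M₀, hM₀.1, 1, le_rfl, fun m h₁ h₂ => by omega, ?_⟩
    exact ⟨fun j hj => ⟨hP j hj.2, hj.2⟩, fun h => hiM (h ⟨hi, hP₁ i hi⟩).1⟩
  · rintro rfl
    refine ⟨hM, ?_⟩
    rintro ⟨N, hN, n, -, heq, hss⟩
    obtain ⟨i, ⟨hiN, hin⟩, hi⟩ := Set.exists_of_ssubset hss
    have hiM : i ∉ M := fun h => hi ⟨h, hin⟩
    have hn : 1 < n := by
      rw [← hin, hP₂ i hiM]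
      exact one_lt_two
    have hsub : M ⊆ N := fun j hj =>
      ((heq 1 le_rfl hn).ge ⟨hj, hP₁ j hj⟩ : j ∈ {i ∈ N | P i = 1}).1
    exact hiM (hM.eq_of_subset hN hsub ▸ hiN)
end

section
/- Suppose R is the result of merging the family (K i) under some priority ordering. Then for every maxset M of (K i) the following are equivalent: (i) Mod(M) ∩ R ≠ ∅; (ii) Mod(M) ⊆ R; (iii) M is minimal with respect to every priority ordering P whose result of merging is R. -/
theorem Maxset.mem_iff {V ι : Type*} {K : ι → Set (V → Bool)} {M : Set ι}
    (hM : Maxset K M) {I : V → Bool} (hI : I ∈ KMod K M) (i : ι) : i ∈ M ↔ I ∈ K i := by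
  refine ⟨hI i, fun h => by_contra fun hi => hM.2 i hi ⟨I, ?_⟩⟩
  rintro j (hj | rfl)
  · exact hI j hj
  · exact h

/-- Maxsets with a common model are equal. -/
theorem Maxset.eq_of_mem {V ι : Type*} {K : ι → Set (V → Bool)} {M N : Set ι}
    (hM : Maxset K M) (hN : Maxset K N) {I : V → Bool}
    (hIM : I ∈ KMod K M) (hIN : I ∈ KMod K N) : M = N :=
  Set.ext fun i => (hM.mem_iff hIM i).trans (hN.mem_iff hIN i).symm

theorem Maxset.minimalMaxset_of_mem_mergeResult {V ι : Type*} {K : ι → Set (V → Bool)}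
    {P : ι → ℕ} {M : Set ι} (hM : Maxset K M) {I : V → Bool}
    (hIM : I ∈ KMod K M) (hI : I ∈ MergeResult K P) : MinimalMaxset K P M := by
  obtain ⟨N, hN, hIN⟩ := Set.mem_iUnion₂.1 hI
  exact hM.eq_of_mem hN.1 hIM hIN ▸ hN

theorem MinimalMaxset.kMod_subset_mergeResult {V ι : Type*} {K : ι → Set (V → Bool)}
    {P : ι → ℕ} {M : Set ι} (hM : MinimalMaxset K P M) : KMod K M ⊆ MergeResult K P :=
  fun _ hI => Set.mem_iUnion₂.2 ⟨M, hM, hI⟩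

theorem stmt_11 {V ι : Type*} [Fintype V] [Fintype ι] [Nonempty ι]
    (K : ι → Set (V → Bool)) (hK : ∀ i, (K i).Nonempty)
    (R : Set (V → Bool))
    (hR : ∃ P : ι → ℕ, PriorityOrdering P ∧ MergeResult K P = R)
    (M : Set ι) (hM : Maxset K M) :
    ((KMod K M ∩ R).Nonempty ↔ KMod K M ⊆ R) ∧
    (KMod K M ⊆ R ↔
      ∀ P : ι → ℕ, PriorityOrdering P → MergeResult K P = R →
        MinimalMaxset K P M) := by
  obtain ⟨P, hP, rfl⟩ := hR
  obtain ⟨I, hI⟩ := hM.1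
  refine ⟨⟨?_, fun h => ⟨I, hI, h hI⟩⟩, fun h Q _ hQ => ?_, fun h => ?_⟩
  · rintro ⟨J, hJM, hJ⟩
    exact (hM.minimalMaxset_of_mem_mergeResult hJM hJ).kMod_subset_mergeResult
  · exact hM.minimalMaxset_of_mem_mergeResult hI (hQ ▸ h hI)
  · exact (h P hP rfl).kMod_subset_mergeResult
end

section
/- Let v be an assignment that obtains a given se-graph, and let x₀, x₁, …, x_k (k ≥ 2) be vertices such that {x_i, x_{i+1}} is a selected edge of the graph for every i < k. Then v x_{i+2} = v x_i for every i ≤ k − 2; that is, the values along the chain alternate between two values. -/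
/-- A selected-excluded graph: a finite simple graph in which every vertex is
incident to at least one edge, whose edges are partitioned into selected edges
(`Sel`) and excluded ones (the remaining adjacent pairs). -/
structure SEGraph (Ω : Type*) where
  Adj : Ω → Ω → Prop
  adj_symm : ∀ x y, Adj x y → Adj y x
  adj_irrefl : ∀ x, ¬ Adj x x
  covers : ∀ x, ∃ y, Adj x y
  Sel : Ω → Ω → Prop
  sel_symm : ∀ x y, Sel x y → Sel y x
  sel_adj : ∀ x y, Sel x y → Adj x y

/-- An edge is excluded when it is an edge but not a selected one. -/
def SEGraph.Exc {Ω : Type*} (G : SEGraph Ω) (x y : Ω) : Prop :=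
  G.Adj x y ∧ ¬ G.Sel x y

/-- An assignment of priority classes to the vertices. -/
def Assignment {Ω : Type*} (v : Ω → ℕ) : Prop :=
  (∀ x, 1 ≤ v x) ∧ (∃ x, v x = 1)

/-- The comparison between sets of vertices induced by an assignment `v`. -/
def VLt {Ω : Type*} (v : Ω → ℕ) (M N : Set Ω) : Prop :=
  ∃ n, 1 ≤ n ∧ (∀ m, 1 ≤ m → m < n → {x ∈ M | v x = m} = {x ∈ N | v x = m}) ∧
    {x ∈ N | v x = n} ⊂ {x ∈ M | v x = n}

/-- The candidates the minimality of an edge is checked against: all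
singletons of vertices and all (endpoint sets of) edges of the graph. -/
def SEGraph.Cand {Ω : Type*} (G : SEGraph Ω) : Set (Set Ω) :=
  {s | (∃ x : Ω, s = {x}) ∨ (∃ x y : Ω, G.Adj x y ∧ s = {x, y})}

/-- An edge, identified with its set of endpoints, is minimal with respect to
`v` if no candidate set is strictly below it. -/
def SEGraph.MinimalEdge {Ω : Type*} (G : SEGraph Ω) (v : Ω → ℕ) (x y : Ω) :
    Prop :=
  ¬ ∃ c ∈ G.Cand, VLt v c ({x, y} : Set Ω)

/-- An assignment obtains the se-graph when the minimal edges are exactly the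
selected ones. -/
def SEGraph.Obtains {Ω : Type*} (G : SEGraph Ω) (v : Ω → ℕ) : Prop :=
  ∀ x y : Ω, G.Adj x y → (G.MinimalEdge v x y ↔ G.Sel x y)

/-- An endpoint of a minimal edge `{a, b}` has value at most that of every other
neighbour of `b`. -/
theorem SEGraph.MinimalEdge.le_of_adj {Ω : Type*} {G : SEGraph Ω} {v : Ω → ℕ}
    (hpos : ∀ x, 1 ≤ v x) {a b c : Ω} (hmin : G.MinimalEdge v a b) (hbc : G.Adj b c) :
    v a ≤ v c := by
  by_contra! hlt
  have hcb : c ≠ b := fun h => G.adj_irrefl b (h ▸ hbc)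
  have hca : c ≠ a := by rintro rfl; exact lt_irrefl _ hlt
  refine hmin ⟨{b, c}, Or.inr ⟨b, c, hbc, rfl⟩, v c, hpos c, ?_, ?_⟩
  · intro m _ hm
    ext y
    simp only [Set.mem_ofPred_eq, Set.mem_insert_iff, Set.mem_singleton_iff]
    grind
  · refine (Set.ssubset_iff_of_subset ?_).2 ⟨c, by simp, by simp [hcb, hca]⟩
    rintro y ⟨rfl | rfl, hy⟩
    · exact absurd hy hlt.ne'
    · exact ⟨Or.inl rfl, hy⟩

theorem stmt_14 {Ω : Type*} [Fintype Ω] (G : SEGraph Ω) (v : Ω → ℕ)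
    (hv : Assignment v) (hobt : G.Obtains v)
    (x : ℕ → Ω) (k : ℕ) (hk : 2 ≤ k)
    (hchain : ∀ i < k, G.Sel (x i) (x (i + 1))) :
    ∀ i, i + 2 ≤ k → v (x (i + 2)) = v (x i) := by
  have sel_le : ∀ a b c, G.Sel a b → G.Sel b c → v a ≤ v c := fun a b c hab hbc =>
    ((hobt a b (G.sel_adj a b hab)).2 hab).le_of_adj hv.1 (G.sel_adj b c hbc)
  intro i hi
  have h₁ := hchain i (by omega)
  have h₂ := hchain (i + 1) (by omega)
  exact le_antisymm (sel_le _ _ _ (G.sel_symm _ _ h₂) (G.sel_symm _ _ h₁)) (sel_le _ _ _ h₁ h₂)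
end

section
/- Let v be an assignment that obtains a given se-graph. If a, b, c are pairwise distinct vertices such that {a,b}, {b,c}, {a,c} are all selected edges of the graph, then v a = v b = v c = 1. -/
section

variable {Ω : Type*} {G : SEGraph Ω} {v : Ω → ℕ}

/-- A minimal edge has an endpoint of priority class `1`. -/
theorem SEGraph.MinimalEdge.eq_one_or_eq_one (hv : Assignment v) {x y : Ω}
    (h : G.MinimalEdge v x y) : v x = 1 ∨ v y = 1 := by
  by_contra! hxy
  obtain ⟨w, hw⟩ := hv.2
  refine h ⟨{w}, Or.inl ⟨w, rfl⟩, 1, le_rfl, fun m _ _ => by omega, ?_, ?_⟩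
  · rintro z ⟨rfl | rfl, hz⟩
    · exact absurd hz hxy.1
    · exact absurd hz hxy.2
  · intro hsub
    obtain ⟨rfl | rfl, hz⟩ := hsub (show w ∈ {z ∈ ({w} : Set Ω) | v z = 1} from ⟨rfl, hw⟩)
    · exact hxy.1 hz
    · exact hxy.2 hz

/-- If both endpoints of an edge at `x` have priority class `1`, then so do both endpoints of
every minimal edge at `x`. -/
theorem SEGraph.MinimalEdge.eq_one_of_adj {x y z : Ω} (h : G.MinimalEdge v x z)
    (hxy : G.Adj x y) (hx : v x = 1) (hy : v y = 1) : v z = 1 := by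
  by_contra hz
  refine h ⟨{x, y}, Or.inr ⟨x, y, hxy, rfl⟩, 1, le_rfl, fun m _ _ => by omega, ?_, ?_⟩
  · rintro w ⟨rfl | rfl, hw⟩
    · exact ⟨Or.inl rfl, hw⟩
    · exact absurd hw hz
  · intro hsub
    obtain ⟨rfl | rfl, -⟩ :=
      hsub (show y ∈ {w ∈ ({x, y} : Set Ω) | v w = 1} from ⟨Or.inr rfl, hy⟩)
    · exact G.adj_irrefl _ hxy
    · exact hz hy

end

theorem stmt_15 {Ω : Type*} [Fintype Ω] (G : SEGraph Ω) (v : Ω → ℕ)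
    (hv : Assignment v) (hobt : G.Obtains v)
    (a b c : Ω) (hab : a ≠ b) (hac : a ≠ c) (hbc : b ≠ c)
    (sab : G.Sel a b) (sbc : G.Sel b c) (sac : G.Sel a c) :
    v a = 1 ∧ v b = 1 ∧ v c = 1 := by
  have minimal {x y : Ω} (h : G.Sel x y) : G.MinimalEdge v x y :=
    (hobt x y (G.sel_adj x y h)).2 h
  have sba := G.sel_symm _ _ sab
  have a_of := (minimal sba).eq_one_of_adj (G.sel_adj _ _ sbc)
  have b_of := (minimal sab).eq_one_of_adj (G.sel_adj _ _ sac)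
  have c_of := (minimal sac).eq_one_of_adj (G.sel_adj _ _ sab)
  have := (minimal sab).eq_one_or_eq_one hv
  have := (minimal sbc).eq_one_or_eq_one hv
  have := (minimal sac).eq_one_or_eq_one hv
  tauto
end

section
/- Let v be an assignment that obtains a given se-graph, and let x₀, x₁, …, x_{2k} (k ≥ 1) be vertices such that {x_{2i}, x_{2i+1}} is an excluded edge of the graph for every i < k and {x_{2i+1}, x_{2i+2}} is a selected edge of the graph for every i < k. If v x₀ = 1, then v x_{2i} = 1 for every i ≤ k, v x_{2i+1} > 1 for every i < k, and v x_{2i+1} < v x_{2i+3} for every i < k − 1. -/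
theorem VLt.exists_notMem {Ω : Type*} {v : Ω → ℕ} (hpos : ∀ x, 1 ≤ v x) {M N : Set Ω}
    (h : VLt v M N) :
    ∃ z ∈ M, z ∉ N ∧ ∀ a ∈ N, v a ≤ v z → a ∈ M := by
  obtain ⟨n, -, heq, hss⟩ := h
  obtain ⟨z, ⟨hzM, hzn⟩, hz⟩ := Set.exists_of_ssubset hss
  refine ⟨z, hzM, fun hzN => hz ⟨hzN, hzn⟩, fun a ha hav => ?_⟩
  rcases (hzn ▸ hav).lt_or_eq with hlt | hav
  · have : a ∈ {x ∈ N | v x = v a} := ⟨ha, rfl⟩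
    rw [← heq (v a) (hpos a) hlt] at this
    exact this.1
  · exact (hss.subset ⟨ha, hav⟩).1

/-- An edge with an endpoint `a` of value `1` is minimal exactly when its other endpoint has the
least value among the neighbours of `a`. -/
theorem SEGraph.minimalEdge_iff {Ω : Type*} (G : SEGraph Ω) {v : Ω → ℕ} (hpos : ∀ x, 1 ≤ v x)
    {a b : Ω} (hab : G.Adj a b) (ha : v a = 1) :
    G.MinimalEdge v a b ↔ ∀ d, G.Adj a d → v b ≤ v d := by
  have hne : a ≠ b := fun h => G.adj_irrefl b (h ▸ hab)
  constructor
  · intro hmin d had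
    by_contra! hlt
    have hda : d ≠ a := fun h => G.adj_irrefl a (h ▸ had)
    refine hmin ⟨{a, d}, Or.inr ⟨a, d, had, rfl⟩, v d, hpos d, fun m _ hm => ?_, ?_⟩
    · ext z
      simp only [Set.mem_ofPred_eq, Set.mem_insert_iff, Set.mem_singleton_iff]
      grind
    · rw [Set.ssubset_iff_exists]
      refine ⟨fun z => ?_, d, ?_, ?_⟩ <;>
        simp only [Set.mem_ofPred_eq, Set.mem_insert_iff, Set.mem_singleton_iff] <;> grind
  · rintro hle ⟨c, hc, hlt⟩
    obtain ⟨z, hz, hzN, hmem⟩ := hlt.exists_notMem hpos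
    have hac : a ∈ c := hmem a (by simp) (ha ▸ hpos z)
    have hbc : v b ≤ v z → b ∈ c := hmem b (by simp)
    have hza : z ≠ a := by rintro rfl; simp at hzN
    have hzb : z ≠ b := by rintro rfl; simp at hzN
    rcases hc with ⟨x, rfl⟩ | ⟨x, y, hxy, rfl⟩
    · exact hza (hz.trans hac.symm)
    · have hyx := G.adj_symm _ _ hxy
      simp only [Set.mem_insert_iff, Set.mem_singleton_iff] at hz hac hbc
      grind

/-- A minimal edge has an endpoint of value `1`. -/
theorem SEGraph.MinimalEdge.eq_one {Ω : Type*} {G : SEGraph Ω} {v : Ω → ℕ}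
    (hv : Assignment v) {a b : Ω} (hmin : G.MinimalEdge v a b) (ha : 1 < v a) : v b = 1 := by
  obtain ⟨x, hx⟩ := hv.2
  by_contra hb
  refine hmin ⟨{x}, Or.inl ⟨x, rfl⟩, 1, le_rfl, fun m _ _ => by omega, ?_⟩
  rw [Set.ssubset_iff_exists]
  refine ⟨fun z => ?_, x, ?_, ?_⟩ <;>
    simp only [Set.mem_ofPred_eq, Set.mem_insert_iff, Set.mem_singleton_iff] <;> grind

theorem stmt_16 {Ω : Type*} [Fintype Ω] (G : SEGraph Ω) (v : Ω → ℕ)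
    (hv : Assignment v) (hobt : G.Obtains v)
    (x : ℕ → Ω) (k : ℕ) (hk : 1 ≤ k)
    (hexc : ∀ i < k, G.Exc (x (2 * i)) (x (2 * i + 1)))
    (hsel : ∀ i < k, G.Sel (x (2 * i + 1)) (x (2 * i + 2)))
    (h0 : v (x 0) = 1) :
    (∀ i ≤ k, v (x (2 * i)) = 1) ∧
    (∀ i < k, 1 < v (x (2 * i + 1))) ∧
    (∀ i, i + 1 < k → v (x (2 * i + 1)) < v (x (2 * i + 3))) := by
  have minimal_of_sel {a b : Ω} (h : G.Sel a b) : G.MinimalEdge v a b :=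
    (hobt a b (G.sel_adj a b h)).2 h
  have exc_lt {a b : Ω} (h : G.Exc a b) (ha : v a = 1) : ∃ d, G.Adj a d ∧ v d < v b := by
    have := mt (hobt a b h.1).1 h.2
    rw [G.minimalEdge_iff hv.1 h.1 ha] at this
    push Not at this
    exact this
  have one_lt {a b : Ω} (h : G.Exc a b) (ha : v a = 1) : 1 < v b := by
    obtain ⟨d, -, hd⟩ := exc_lt h ha
    exact (hv.1 d).trans_lt hd
  have heven : ∀ i ≤ k, v (x (2 * i)) = 1 := by
    intro i
    induction i with
    | zero => exact fun _ => h0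
    | succ i ih =>
      intro hi
      exact (minimal_of_sel (hsel i hi)).eq_one hv (one_lt (hexc i hi) (ih (by omega)))
  refine ⟨heven, fun i hi => one_lt (hexc i hi) (heven i hi.le), fun i hi => ?_⟩
  have h1 : v (x (2 * i + 2)) = 1 := heven (i + 1) hi.le
  have hs := G.sel_symm _ _ (hsel i (by omega))
  obtain ⟨d, had, hd⟩ := exc_lt (hexc (i + 1) hi) h1
  exact ((G.minimalEdge_iff hv.1 (G.sel_adj _ _ hs) h1).1 (minimal_of_sel hs) d had).trans_lt hd
end

section
/- For every natural number n ≥ 1 there exists an se-graph such that some assignment obtains it, and every assignment v that obtains it takes at least n distinct values, i.e., the image of v on the vertex set has at least n elements. -/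
theorem not_minimalEdge_of_lt {Ω : Type*} (G : SEGraph Ω) {v : Ω → ℕ}
    (hv : ∀ x, 1 ≤ v x) {x y w : Ω} (hxw : G.Adj x w) (hlt : v w < v y) :
    ¬ G.MinimalEdge v x y := by
  have hne : w ≠ x := by
    rintro rfl
    exact G.adj_irrefl _ hxw
  have hwy : w ≠ y := by
    rintro rfl
    exact lt_irrefl _ hlt
  refine not_not.mpr ⟨{x, w}, Or.inr ⟨x, w, hxw, rfl⟩, v w, hv w, ?_, ?_⟩
  · intro m _ hm
    ext u
    simp only [Set.mem_insert_iff, Set.mem_singleton_iff, Set.mem_ofPred_eq]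
    constructor <;> rintro ⟨rfl | rfl, hu⟩ <;> first | exact ⟨Or.inl rfl, hu⟩ | omega
  · refine (Set.ssubset_iff_of_subset ?_).mpr ⟨w, ⟨by simp, rfl⟩, by simp [hne, hwy]⟩
    rintro u ⟨rfl | rfl, hu⟩
    · exact ⟨by simp, hu⟩
    · omega

theorem minimalEdge_comm {Ω : Type*} (G : SEGraph Ω) (v : Ω → ℕ) (x y : Ω) :
    G.MinimalEdge v x y ↔ G.MinimalEdge v y x := by
  simp only [SEGraph.MinimalEdge, Set.pair_comm x y]

theorem minimalEdge_of_eq_one {Ω : Type*} (G : SEGraph Ω) {v : Ω → ℕ}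
    (hv : ∀ x, 1 ≤ v x) {x y : Ω} (hxy : G.Adj x y) (hx : v x = 1)
    (hmin : ∀ w, G.Adj x w → v y ≤ v w) : G.MinimalEdge v x y := by
  rintro ⟨c, hc, n, hn, heq, hss⟩
  have mem_of_le : ∀ u ∈ ({x, y} : Set Ω), v u ≤ n → u ∈ c := by
    intro u hu hun
    rcases hun.lt_or_eq with h | h
    · exact ((heq (v u) (hv u) h).symm.subset ⟨hu, rfl⟩).1
    · exact (hss.subset ⟨hu, h⟩).1
  have hxc : x ∈ c := mem_of_le x (by simp) (hx.trans_le hn)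
  obtain ⟨u, ⟨huc, hun⟩, hu⟩ := Set.exists_of_ssubset hss
  have hu' : u ∉ ({x, y} : Set Ω) := fun h => hu ⟨h, hun⟩
  have hux : u ≠ x := by
    rintro rfl
    simp at hu'
  have huy : u ≠ y := by
    rintro rfl
    simp at hu'
  have hyx : y ≠ x := by
    rintro rfl
    exact G.adj_irrefl _ hxy
  have hcu : G.Adj x u ∧ c = {x, u} := by
    rcases hc with ⟨z, rfl⟩ | ⟨z, w, hzw, rfl⟩
    · exact absurd (huc.trans hxc.symm) hux
    · rcases hxc with rfl | rfl <;> rcases huc with rfl | rfl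
      · exact absurd rfl hux
      · exact ⟨hzw, rfl⟩
      · exact ⟨G.adj_symm _ _ hzw, Set.pair_comm _ _⟩
      · exact absurd rfl hux
  have hyc := mem_of_le y (by simp) ((hmin u hcu.1).trans_eq hun)
  rw [hcu.2] at hyc
  rcases hyc with h | h
  · exact hyx h
  · exact huy h.symm

/-- Given an assignment, a minimal edge has an endpoint of value `1`. -/
theorem eq_one_or_eq_one_of_minimalEdge {Ω : Type*} (G : SEGraph Ω) {v : Ω → ℕ}
    (hv : Assignment v) {x y : Ω} (h : G.MinimalEdge v x y) : v x = 1 ∨ v y = 1 := by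
  obtain ⟨z, hz⟩ := hv.2
  by_contra! hne
  have hempty : {u ∈ ({x, y} : Set Ω) | v u = 1} = ∅ := by
    ext u
    simp only [Set.mem_insert_iff, Set.mem_singleton_iff, Set.mem_ofPred_eq,
      Set.mem_empty_iff_false, iff_false, not_and]
    rintro (rfl | rfl)
    exacts [hne.1, hne.2]
  refine h ⟨{z}, Or.inl ⟨z, rfl⟩, 1, le_rfl, fun m h1 h2 => by omega, ?_⟩
  rw [hempty]
  exact Set.Nonempty.empty_ssubset ⟨z, rfl, hz⟩

/-- A selected triangle `t` together with vertices `a i` and `b i`. -/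
inductive Vertex (n : ℕ)
  | t : Fin 3 → Vertex n
  | a : Fin n → Vertex n
  | b : Fin n → Vertex n

namespace Vertex

variable {n : ℕ}

instance : Fintype (Vertex n) :=
  Fintype.ofEquiv (Fin 3 ⊕ Fin n ⊕ Fin n)
    { toFun := Sum.elim t (Sum.elim a b)
      invFun
        | t i => .inl i
        | a i => .inr (.inl i)
        | b i => .inr (.inr i)
      left_inv := by rintro (i | i | i) <;> rfl
      right_inv := by rintro (i | i | i) <;> rfl }

/-- The triangle is joined to every `a i`, and `b i` is joined to `a j` for `i ≤ j`. -/
def Adj : Vertex n → Vertex n → Prop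
  | t i, t j => i ≠ j
  | t _, a _ => True
  | a _, t _ => True
  | b i, a j => i ≤ j
  | a j, b i => i ≤ j
  | _, _ => False

/-- The selected edges are those of the triangle and those joining `b i` to `a i`. -/
def Sel : Vertex n → Vertex n → Prop
  | t i, t j => i ≠ j
  | b i, a j => i = j
  | a j, b i => i = j
  | _, _ => False

/-- The se-graph on `Vertex n` in which the values of the `a i` are forced to increase. -/
def seGraph (n : ℕ) : SEGraph (Vertex n) where
  Adj := Adj
  adj_symm := by rintro (i | i | i) (j | j | j) <;> simp [Adj, eq_comm]
  adj_irrefl := by rintro (i | i | i) <;> simp [Adj]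
  covers := by
    rintro (i | i | i)
    · exact ⟨t (i + 1), by simp [Adj]⟩
    · exact ⟨t 0, trivial⟩
    · exact ⟨a i, le_rfl⟩
  Sel := Sel
  sel_symm := by rintro (i | i | i) (j | j | j) <;> simp [Sel, eq_comm]
  sel_adj := by
    rintro (i | i | i) (j | j | j) <;> simp +contextual [Sel, Adj]

/-- The values `i + 2` on `a i` and `1` elsewhere. -/
def value : Vertex n → ℕ
  | a i => i + 2
  | _ => 1

theorem one_le_value (x : Vertex n) : 1 ≤ value x := by
  rcases x with i | i | i <;> simp [value]

theorem assignment_value : Assignment (value (n := n)) :=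
  ⟨one_le_value, t 0, rfl⟩

theorem not_minimalEdge_t_a (i : Fin 3) (j : Fin n) :
    ¬ (seGraph n).MinimalEdge value (t i) (a j) :=
  not_minimalEdge_of_lt (w := t (i + 1)) _ one_le_value (show i ≠ i + 1 by simp)
    (by simp [value])

theorem minimalEdge_b_a_iff {i j : Fin n} (hij : i ≤ j) :
    (seGraph n).MinimalEdge value (b i) (a j) ↔ i = j := by
  constructor
  · intro h
    by_contra hne
    refine not_minimalEdge_of_lt (w := a i) _ one_le_value (le_refl i) ?_ h
    have := lt_of_le_of_ne hij hne
    simpa [value] using this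
  · rintro rfl
    refine minimalEdge_of_eq_one _ one_le_value (le_refl i) rfl ?_
    rintro (k | k | k) hk
    · exact hk.elim
    · have : i ≤ k := hk
      simpa [value] using this
    · exact hk.elim

theorem obtains_value : (seGraph n).Obtains value := by
  rintro (i | i | i) (j | j | j) hij
  · exact iff_of_true (minimalEdge_of_eq_one _ one_le_value hij rfl fun w _ => one_le_value w) hij
  · exact iff_of_false (not_minimalEdge_t_a i j) id
  · exact hij.elim
  · rw [minimalEdge_comm]
    exact iff_of_false (not_minimalEdge_t_a j i) id
  · exact hij.elim
  · rw [minimalEdge_comm]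
    exact minimalEdge_b_a_iff hij
  · exact hij.elim
  · exact minimalEdge_b_a_iff hij
  · exact hij.elim

variable {v : Vertex n → ℕ}

/-- The triangle has value `1` throughout. -/
theorem eq_one_of_obtains (hv : Assignment v) (h : (seGraph n).Obtains v) (i : Fin 3) :
    v (t i) = 1 := by
  have hmin : ∀ {j k : Fin 3}, j ≠ k → (seGraph n).MinimalEdge v (t j) (t k) :=
    fun {j k} hjk => (h (t j) (t k) hjk).mpr hjk
  by_contra hi
  have h₁ : i ≠ i + 1 := by simp
  have h₂ : i ≠ i + 2 := by clear * -; revert i; decide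
  have h₁₂ : i + 1 ≠ i + 2 := by clear * -; revert i; decide
  have v₁ := (eq_one_or_eq_one_of_minimalEdge _ hv (hmin h₁)).resolve_left hi
  have v₂ := (eq_one_or_eq_one_of_minimalEdge _ hv (hmin h₂)).resolve_left hi
  have hvi := hv.1 (t i)
  exact not_minimalEdge_of_lt (w := t (i + 2)) _ hv.1 h₁₂ (by omega) (hmin h₁.symm)

theorem a_ne_one_of_obtains (hv : Assignment v) (h : (seGraph n).Obtains v) (j : Fin n) :
    v (a j) ≠ 1 := by
  intro hj
  refine (h (t 0) (a j) trivial).mp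
    (minimalEdge_of_eq_one _ hv.1 trivial (eq_one_of_obtains hv h 0) fun w _ => ?_)
  exact hj.trans_le (hv.1 w)

theorem b_eq_one_of_obtains (hv : Assignment v) (h : (seGraph n).Obtains v) (i : Fin n) :
    v (b i) = 1 :=
  (eq_one_or_eq_one_of_minimalEdge _ hv ((h (b i) (a i) (le_refl i)).mpr rfl)).resolve_right
    (a_ne_one_of_obtains hv h i)

theorem strictMono_of_obtains (hv : Assignment v) (h : (seGraph n).Obtains v) :
    StrictMono fun i => v (a i) := by
  intro i j hij
  by_contra! hle
  have hsel : (seGraph n).MinimalEdge v (b i) (a i) := (h (b i) (a i) (le_refl i)).mpr rfl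
  refine hij.ne ((h (b i) (a j) hij.le).mp
    (minimalEdge_of_eq_one _ hv.1 hij.le (b_eq_one_of_obtains hv h i) fun w hw => ?_))
  by_contra! hlt
  exact not_minimalEdge_of_lt _ hv.1 hw (hlt.trans_le hle) hsel

end Vertex

theorem stmt_17 (n : ℕ) (hn : 1 ≤ n) :
    ∃ (Ω : Type) (_ : Fintype Ω) (G : SEGraph Ω),
      (∃ v : Ω → ℕ, Assignment v ∧ G.Obtains v) ∧
      ∀ v : Ω → ℕ, Assignment v → G.Obtains v →
        n ≤ (Set.range v).ncard := by
  refine ⟨Vertex n, inferInstance, Vertex.seGraph n,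
    ⟨Vertex.value, Vertex.assignment_value, Vertex.obtains_value⟩, fun v hv h => ?_⟩
  have hinj := (Vertex.strictMono_of_obtains hv h).injective
  calc n = (Set.range fun i => v (Vertex.a i)).ncard := by
        rw [← Set.image_univ, Set.ncard_image_of_injective _ hinj, Set.ncard_univ, Nat.card_fin]
    _ ≤ (Set.range v).ncard :=
        Set.ncard_le_ncard (Set.range_comp_subset_range Vertex.a v) (Set.finite_range v)
end

section
/- Suppose an se-graph contains an alternating cycle: there are vertices x₀, x₁, …, x_m with x_m = x₀, each {x_j, x_{j+1}} (for j < m) an edge of the graph, and indices 0 = j₀ < j₁ < ⋯ < j_{2r} = m (with r ≥ 1) such that for every even t < 2r one has j_{t+1} = j_t + 1 and {x_{j_t}, x_{j_t + 1}} is an excluded edge, and for every odd t < 2r the difference j_{t+1} − j_t is odd and {x_j, x_{j+1}} is a selected edge for every j with j_t ≤ j < j_{t+1}. Then no assignment obtains the se-graph. -/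
namespace SEGraph

variable {Ω : Type*} {G : SEGraph Ω} {v : Ω → ℕ}

lemma Obtains.sel_eq_one_or (hv : Assignment v) (h : G.Obtains v) {a b : Ω} (hs : G.Sel a b) :
    v a = 1 ∨ v b = 1 := by
  by_contra! hne
  obtain ⟨z, hz⟩ := hv.2
  refine (h a b (G.sel_adj _ _ hs)).2 hs ⟨{z}, Or.inl ⟨z, rfl⟩, 1, le_rfl, by omega, ?_⟩
  refine ⟨?_, fun hsub => ?_⟩
  · rintro w ⟨rfl | rfl, hw⟩
    · exact absurd hw hne.1
    · exact absurd hw hne.2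
  · obtain ⟨rfl | rfl, hw⟩ := hsub ⟨rfl, hz⟩
    · exact hne.1 hw
    · exact hne.2 hw

lemma Obtains.sel_le_of_adj (hv : Assignment v) (h : G.Obtains v) {p s q : Ω} (hp : v p = 1)
    (hs : G.Sel p s) (hq : G.Adj p q) : v s ≤ v q := by
  by_contra! hlt
  refine (h p s (G.sel_adj _ _ hs)).2 hs
    ⟨{p, q}, Or.inr ⟨p, q, hq, rfl⟩, v q, hv.1 q, fun k _ hk => ?_, ?_, fun hsub => ?_⟩
  · ext w
    constructor
    · rintro ⟨rfl | rfl, hw⟩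
      · exact ⟨Or.inl rfl, hw⟩
      · omega
    · rintro ⟨rfl | rfl, hw⟩
      · exact ⟨Or.inl rfl, hw⟩
      · omega
  · rintro w ⟨rfl | rfl, hw⟩
    · exact ⟨Or.inl rfl, hw⟩
    · omega
  · obtain ⟨rfl | rfl, hw⟩ := hsub ⟨Or.inr rfl, rfl⟩
    · exact G.adj_irrefl _ hq
    · omega

lemma minimalEdge_of_forall_le (hv : Assignment v) {p q : Ω} (hp : v p = 1)
    (hpq : G.Adj p q) (hq : ∀ z, G.Adj p z → v q ≤ v z) : G.MinimalEdge v p q := by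
  rintro ⟨c, hc, n, hn, heq, hsub, hnot⟩
  have mem_of_le : ∀ w ∈ ({p, q} : Set Ω), v w ≤ n → w ∈ c := by
    intro w hw hwn
    rcases hwn.lt_or_eq with hlt | hwn
    · have hmem : w ∈ {y ∈ ({p, q} : Set Ω) | v y = v w} := ⟨hw, rfl⟩
      rw [← heq _ (hv.1 w) hlt] at hmem
      exact hmem.1
    · exact (hsub ⟨hw, hwn⟩).1
  have hpc : p ∈ c := mem_of_le p (Or.inl rfl) (by omega)
  obtain ⟨w, ⟨hwc, hwn⟩, hw⟩ := Set.not_subset.1 hnot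
  have hwp : w ≠ p := fun e => hw ⟨Or.inl e, hwn⟩
  have hwq : w ≠ q := fun e => hw ⟨Or.inr e, hwn⟩
  obtain ⟨z, rfl⟩ | ⟨y, z, hyz, rfl⟩ := hc
  · exact hwp (hwc.trans hpc.symm)
  · have hpw : G.Adj p w := by
      rcases hpc with rfl | rfl <;> rcases hwc with rfl | rfl
      · exact absurd rfl hwp
      · exact hyz
      · exact G.adj_symm _ _ hyz
      · exact absurd rfl hwp
    have hqc := mem_of_le q (Or.inr rfl) (hwn ▸ hq w hpw)
    have hqp : q ≠ p := fun e => G.adj_irrefl p (e ▸ hpq)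
    simp only [Set.mem_insert_iff, Set.mem_singleton_iff] at hpc hwc hqc
    grind

lemma Obtains.sel_lt_of_exc (hv : Assignment v) (h : G.Obtains v) {p s q : Ω} (hp : v p = 1)
    (hs : G.Sel p s) (hq : G.Exc p q) : v s < v q := by
  by_contra! hle
  exact hq.2 ((h p q hq.1).1 (minimalEdge_of_forall_le hv hp hq.1 fun z hz =>
    hle.trans (h.sel_le_of_adj hv hp hs hz)))

lemma Obtains.eq_of_sel_of_sel (hv : Assignment v) (h : G.Obtains v) {p s t : Ω}
    (hs : G.Sel p s) (ht : G.Sel p t) : v s = v t := by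
  by_cases hp : v p = 1
  · exact le_antisymm (h.sel_le_of_adj hv hp hs (G.sel_adj _ _ ht))
      (h.sel_le_of_adj hv hp ht (G.sel_adj _ _ hs))
  · have := h.sel_eq_one_or hv hs
    have := h.sel_eq_one_or hv ht
    omega

/-- Along a path of selected edges the values of an obtaining assignment have period two. -/
lemma Obtains.selected_path (hv : Assignment v) (h : G.Obtains v) (f : ℕ → Ω) (k : ℕ)
    (hf : ∀ i < 2 * k + 1, G.Sel (f i) (f (i + 1))) :
    v (f (2 * k)) = v (f 0) ∧ v (f (2 * k + 1)) = v (f 1) := by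
  have step : ∀ i, i + 2 ≤ 2 * k + 1 → v (f (i + 2)) = v (f i) := fun i hi =>
    h.eq_of_sel_of_sel hv (hf (i + 1) (by omega)) (G.sel_symm _ _ (hf i (by omega)))
  have main : ∀ l ≤ k, v (f (2 * l)) = v (f 0) ∧ v (f (2 * l + 1)) = v (f 1) := by
    intro l
    induction l with
    | zero => simp
    | succ l ih =>
      intro hl
      obtain ⟨h0, h1⟩ := ih (by omega)
      exact ⟨(step (2 * l) (by omega)).trans h0, (step (2 * l + 1) (by omega)).trans h1⟩
  exact main k le_rfl

/-- A selected edge path of odd length from `a` to `b`, as seen by an assignment: `a'` and `b'` are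
the neighbours of the endpoints on the path. -/
lemma Obtains.exists_of_odd_path (hv : Assignment v) (h : G.Obtains v) (x : ℕ → Ω) {s e : ℕ}
    (hodd : Odd (e - s)) (hx : ∀ i, s ≤ i → i < e → G.Sel (x i) (x (i + 1))) :
    (v (x s) = 1 ∨ v (x e) = 1) ∧ (∃ a', G.Sel (x s) a' ∧ v a' = v (x e)) ∧
      ∃ b', G.Sel (x e) b' ∧ v b' = v (x s) := by
  obtain ⟨k, hk⟩ := hodd
  obtain rfl : e = s + (2 * k + 1) := by omega
  obtain ⟨h0, h1⟩ := h.selected_path hv (fun i => x (s + i)) k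
    fun i hi => hx (s + i) (by omega) (by omega)
  have hfirst := hx s le_rfl (by omega)
  have hlast := hx (s + 2 * k) (by omega) (by omega)
  refine ⟨?_, ⟨_, hfirst, h1.symm⟩, ⟨_, G.sel_symm _ _ hlast, h0⟩⟩
  rw [h1]
  exact h.sel_eq_one_or hv hfirst

end SEGraph

theorem stmt_18 {Ω : Type*} [Fintype Ω] (G : SEGraph Ω)
    (x : ℕ → Ω) (m : ℕ) (j : ℕ → ℕ) (r : ℕ) (hr : 1 ≤ r)
    (hclosed : x m = x 0)
    (hedge : ∀ i < m, G.Adj (x i) (x (i + 1)))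
    (hj0 : j 0 = 0) (hjm : j (2 * r) = m)
    (hmono : ∀ t < 2 * r, j t < j (t + 1))
    (heven : ∀ t < 2 * r, Even t →
      j (t + 1) = j t + 1 ∧ G.Exc (x (j t)) (x (j t + 1)))
    (hodd : ∀ t < 2 * r, Odd t →
      Odd (j (t + 1) - j t) ∧
      ∀ i, j t ≤ i → i < j (t + 1) → G.Sel (x i) (x (i + 1))) :
    ¬ ∃ v : Ω → ℕ, Assignment v ∧ G.Obtains v := by
  rintro ⟨v, hv, h⟩
  have path : ∀ u < r, _ := fun u hu =>
    let hp := hodd (2 * u + 1) (by omega) (odd_two_mul_add_one u)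
    h.exists_of_odd_path hv x hp.1 hp.2
  let D : ℕ → ℤ := fun u => (v (x (j (2 * u + 1 + 1))) : ℤ) - v (x (j (2 * u + 1)))
  have drop : ∀ u < r, ∀ w < r, G.Exc (x (j (2 * u + 1 + 1))) (x (j (2 * w + 1))) → D w < D u := by
    intro u hu w hw hexc
    obtain ⟨hab, -, b', hb', hvb'⟩ := path u hu
    obtain ⟨hcd, ⟨c', hc', hvc'⟩, -⟩ := path w hw
    have hlt := fun hb => h.sel_lt_of_exc hv hb hb' hexc
    have hgt := fun hc => h.sel_lt_of_exc hv hc hc'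
      ⟨G.adj_symm _ _ hexc.1, fun hs => hexc.2 (G.sel_symm _ _ hs)⟩
    have := hv.1 (x (j (2 * u + 1 + 1)))
    have := hv.1 (x (j (2 * u + 1)))
    have := hv.1 (x (j (2 * w + 1)))
    simp only [D]
    omega
  have anti : ∀ u < r, D u ≤ D 0 := by
    intro u
    induction u with
    | zero => simp
    | succ u ih =>
      intro hu
      obtain ⟨he, hexc⟩ := heven (2 * u + 1 + 1) (by omega) ⟨u + 1, by ring⟩
      rw [← he] at hexc
      exact (drop u (by omega) (u + 1) hu hexc).le.trans (ih (by omega))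
  have hexc := (heven 0 (by omega) Even.zero)
  rw [← hexc.1] at hexc
  refine absurd (anti (r - 1) (by omega)) (not_le.2 (drop (r - 1) (by omega) 0 hr ?_))
  rw [show 2 * (r - 1) + 1 + 1 = 2 * r by omega, hjm, hclosed]
  simpa [hj0] using hexc.2
end

section
/- For a set R of interpretations, R equals the union of Mod(M) over the members M of some set of maxsets of the family (K i) if and only if for every interpretation I ∈ R the set M_I = {i ∈ ι | I ∈ K i} satisfies both: Mod(M_I) ⊆ R, and M_I ∪ {j} is inconsistent for every j ∈ ι \ M_I. -/
/-- A maxset is exactly the set of formulae satisfied by any of its models. -/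
theorem Maxset.setOf_mem_eq {V ι : Type*} {K : ι → Set (V → Bool)} {M : Set ι}
    (hM : Maxset K M) {I : V → Bool} (hI : I ∈ KMod K M) : {i : ι | I ∈ K i} = M := by
  refine Set.Subset.antisymm (fun j hj => ?_) hI
  by_contra hjM
  refine hM.2 j hjM ⟨I, ?_⟩
  rintro i (hi | rfl)
  exacts [hI i hi, hj]

theorem stmt_19 {V ι : Type*} [Fintype V] [Fintype ι] [Nonempty ι]
    (K : ι → Set (V → Bool)) (hK : ∀ i, (K i).Nonempty)
    (R : Set (V → Bool)) :
    (∃ S : Set (Set ι), (∀ M ∈ S, Maxset K M) ∧ R = ⋃ M ∈ S, KMod K M) ↔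
      ∀ I ∈ R,
        KMod K {i : ι | I ∈ K i} ⊆ R ∧
        ∀ j ∉ {i : ι | I ∈ K i},
          ¬ ConsistentSet K ({i : ι | I ∈ K i} ∪ {j}) := by
  constructor
  · rintro ⟨S, hS, rfl⟩ I hI
    obtain ⟨M, hMS, hIM⟩ := Set.mem_iUnion₂.1 hI
    rw [(hS M hMS).setOf_mem_eq hIM]
    exact ⟨Set.subset_biUnion_of_mem (u := KMod K) hMS, (hS M hMS).2⟩
  · intro h
    refine ⟨(fun I => {i : ι | I ∈ K i}) '' R, ?_, Set.Subset.antisymm (fun I hI => ?_) ?_⟩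
    · rintro _ ⟨I, hI, rfl⟩
      exact ⟨⟨I, fun _ hi => hi⟩, (h I hI).2⟩
    · exact Set.mem_iUnion₂.2 ⟨_, ⟨I, hI, rfl⟩, fun _ hi => hi⟩
    · refine Set.iUnion₂_subset ?_
      rintro _ ⟨I, hI, rfl⟩
      exact (h I hI).1
end
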